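/- There exists a unique function Q̲ : S × A → ℝ such that T̲Q̲ = Q̲, i.e., the worst-attack Bellman operator has a unique fixed point. -/

import Mathlib

theorem Finset.inf'_le_inf'_add {ι : Type*} {s : Finset ι} (hs : s.Nonempty) {f g : ι → ℝ}
    {d : ℝ} (h : ∀ i ∈ s, f i ≤ g i + d) : s.inf' hs f ≤ s.inf' hs g + d := by
  obtain ⟨i, hi, hgi⟩ := s.exists_mem_eq_inf' hs g
  rw [hgi]
  exact (s.inf'_le f hi).trans (h i hi)

theorem Finset.abs_inf'_sub_inf'_le {ι : Type*} {s : Finset ι} (hs : s.Nonempty) {f g : ι → ℝ}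
    {d : ℝ} (h : ∀ i ∈ s, |f i - g i| ≤ d) : |s.inf' hs f - s.inf' hs g| ≤ d := by
  have hfg : s.inf' hs f ≤ s.inf' hs g + d :=
    Finset.inf'_le_inf'_add hs fun i hi => by linarith [(abs_le.mp (h i hi)).2]
  have hgf : s.inf' hs g ≤ s.inf' hs f + d :=
    Finset.inf'_le_inf'_add hs fun i hi => by linarith [(abs_le.mp (h i hi)).1]
  rw [abs_le]
  constructor <;> linarith

theorem abs_sum_mul_sub_sum_mul_le {ι : Type*} [Fintype ι] {p u v : ι → ℝ} {d : ℝ}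
    (hp0 : ∀ i, 0 ≤ p i) (hp1 : ∑ i, p i = 1) (h : ∀ i, |u i - v i| ≤ d) :
    |∑ i, p i * u i - ∑ i, p i * v i| ≤ d := by
  calc |∑ i, p i * u i - ∑ i, p i * v i| = |∑ i, p i * (u i - v i)| := by
        simp only [mul_sub, Finset.sum_sub_distrib]
    _ ≤ ∑ i, |p i * (u i - v i)| := Finset.abs_sum_le_sum_abs _ _
    _ ≤ ∑ i, p i * d := by
        refine Finset.sum_le_sum fun i _ => ?_
        rw [abs_mul, abs_of_nonneg (hp0 i)]
        exact mul_le_mul_of_nonneg_left (h i) (hp0 i)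
    _ = d := by rw [← Finset.sum_mul, hp1, one_mul]

/-- The worst-attack Bellman operator has a unique fixed point. -/
theorem worstAttackBellman_existsUnique_fixedPoint
    {S A : Type*} [Fintype S] [Fintype A] [Nonempty S] [Nonempty A]
    (P : S → A → S → ℝ) (R : S → A → ℝ) (γ : ℝ)
    (hP0 : ∀ s a s', 0 ≤ P s a s') (hP1 : ∀ s a, ∑ s', P s a s' = 1)
    (hγ0 : 0 ≤ γ) (hγ1 : γ < 1)
    (Aadv : S → Finset A) (hAadv : ∀ s, (Aadv s).Nonempty)
    (T : (S → A → ℝ) → (S → A → ℝ))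
    (hT : ∀ Q s a, T Q s a =
      R s a + γ * ∑ s', P s a s' * (Aadv s').inf' (hAadv s') (Q s')) :
    ∃! Q : S → A → ℝ, T Q = Q := by
  have hT_contract : ContractingWith ⟨γ, hγ0⟩ T := by
    refine ⟨by exact_mod_cast hγ1, LipschitzWith.of_dist_le_mul fun Q Q' => ?_⟩
    change dist (T Q) (T Q') ≤ γ * dist Q Q'
    have hd : 0 ≤ γ * dist Q Q' := mul_nonneg hγ0 dist_nonneg
    refine (dist_pi_le_iff hd).mpr fun s => (dist_pi_le_iff hd).mpr fun a => ?_
    rw [Real.dist_eq, hT, hT, add_sub_add_left_eq_sub, ← mul_sub, abs_mul, abs_of_nonneg hγ0]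
    refine mul_le_mul_of_nonneg_left ?_ hγ0
    refine abs_sum_mul_sub_sum_mul_le (hP0 s a) (hP1 s a) fun s' => ?_
    refine Finset.abs_inf'_sub_inf'_le (hAadv s') fun a' _ => ?_
    rw [← Real.dist_eq]
    exact (dist_le_pi_dist (Q s') (Q' s') a').trans (dist_le_pi_dist Q Q' s')
  exact ⟨hT_contract.fixedPoint T, hT_contract.fixedPoint_isFixedPt,
    fun Q hQ => hT_contract.fixedPoint_unique hQ⟩
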